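/- Let m and n be positive integers. The set QMP(m,n) of admissible spectral triples is a compact subset of (Fin m → ℝ) × (Fin n → ℝ) × (Fin m × Fin n → ℝ). -/

import Mathlib

open Matrix
open scoped ComplexOrder

noncomputable section

/-- A density operator: positive semidefinite with trace 1. -/
def IsDensityOp {I : Type*} [Fintype I] (ρ : Matrix I I ℂ) : Prop :=
  ρ.PosSemidef ∧ ρ.trace = 1

/-- Partial trace over the second tensor factor. -/
def ptraceB {I J : Type*} [Fintype J] (ρ : Matrix (I × J) (I × J) ℂ) :
    Matrix I I ℂ :=
  Matrix.of fun i i' => ∑ j, ρ (i, j) (i', j)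

/-- Partial trace over the first tensor factor. -/
def ptraceA {I J : Type*} [Fintype I] (ρ : Matrix (I × J) (I × J) ℂ) :
    Matrix J J ℂ :=
  Matrix.of fun j j' => ∑ i, ρ (i, j) (i, j')

/-- `a` is the spectrum of `A`: the vector of eigenvalues of the Hermitian matrix `A`
listed in nonincreasing order (with respect to the ordering of the index type given by
the equivalence `e` with `Fin d`). -/
def IsSpectrum {d : ℕ} {I : Type*} [Fintype I] [DecidableEq I]
    (A : Matrix I I ℂ) (e : I ≃ Fin d) (a : I → ℝ) : Prop :=
  ∃ hA : A.IsHermitian,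
    (∃ σ : Equiv.Perm I, a = hA.eigenvalues ∘ σ) ∧ Antitone (a ∘ e.symm)

/-- The set of admissible spectral triples. -/
def QMP (m n : ℕ) :
    Set ((Fin m → ℝ) × (Fin n → ℝ) × (Fin m × Fin n → ℝ)) :=
  {t | ∃ ρ : Matrix (Fin m × Fin n) (Fin m × Fin n) ℂ,
    IsDensityOp ρ ∧
    IsSpectrum (ptraceB ρ) (Equiv.refl (Fin m)) t.1 ∧
    IsSpectrum (ptraceA ρ) (Equiv.refl (Fin n)) t.2.1 ∧
    IsSpectrum ρ finProdFinEquiv t.2.2}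

/-- Two families with the same multiset of values differ by a permutation of the index type. -/
theorem exists_perm_of_map_univ_eq {I α : Type*} [Fintype I] {f g : I → α}
    (h : Multiset.map f Finset.univ.val = Multiset.map g Finset.univ.val) :
    ∃ σ : Equiv.Perm I, f = g ∘ σ := by
  classical
  have key : ∀ y : α, Nonempty ({i // f i = y} ≃ {i // g i = y}) := by
    intro y
    have hy := congrArg (Multiset.count y) h
    rw [Multiset.count_map, Multiset.count_map] at hy
    refine ⟨Fintype.equivOfCardEq ?_⟩
    rw [Fintype.card_subtype, Fintype.card_subtype]
    simpa only [Finset.card_def, Finset.filter_val, eq_comm] using hy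
  let e := fun y => (key y).some
  exact ⟨Equiv.ofFiberEquiv e, funext fun i => (Equiv.ofFiberEquiv_map e i).symm⟩

/-- A vector is the spectrum of a Hermitian matrix if and only if it is ordered and its entries
are the roots of the characteristic polynomial. -/
theorem isSpectrum_iff {d : ℕ} {I : Type*} [Fintype I] [DecidableEq I]
    {A : Matrix I I ℂ} {e : I ≃ Fin d} {a : I → ℝ} :
    IsSpectrum A e a ↔ A.IsHermitian ∧
      (∀ z : ℂ, (Matrix.scalar I z - A).det = ∏ i, (z - (a i : ℂ))) ∧
      Antitone (a ∘ e.symm) := by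
  constructor
  · rintro ⟨hA, ⟨σ, rfl⟩, ha⟩
    refine ⟨hA, fun z => ?_, ha⟩
    rw [← Matrix.eval_charpoly, hA.charpoly_eq, Polynomial.eval_prod]
    simpa using (Equiv.prod_comp σ fun i => z - (hA.eigenvalues i : ℂ)).symm
  · rintro ⟨hA, hdet, ha⟩
    refine ⟨hA, exists_perm_of_map_univ_eq ?_, ha⟩
    have hpoly : A.charpoly = ∏ i, (Polynomial.X - Polynomial.C (a i : ℂ)) :=
      Polynomial.funext fun z => by
        rw [Matrix.eval_charpoly, hdet, Polynomial.eval_prod]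
        simp
    have hroots : A.charpoly.roots = Multiset.map (fun i => (a i : ℂ)) Finset.univ.val := by
      rw [hpoly, Polynomial.roots_prod]
      · simp
      · simp [Finset.prod_ne_zero_iff, Polynomial.X_sub_C_ne_zero]
    rw [hA.roots_charpoly_eq_eigenvalues] at hroots
    simpa [Multiset.map_map, Function.comp_def] using
      (congrArg (Multiset.map Complex.re) hroots).symm

theorem isClosed_setOf_isHermitian {I : Type*} :
    IsClosed {A : Matrix I I ℂ | A.IsHermitian} :=
  isClosed_eq continuous_id.matrix_conjTranspose continuous_id

theorem isClosed_setOf_isSpectrum {d : ℕ} {I : Type*} [Fintype I] [DecidableEq I]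
    (e : I ≃ Fin d) :
    IsClosed {p : Matrix I I ℂ × (I → ℝ) | IsSpectrum p.1 e p.2} := by
  simp only [isSpectrum_iff, Set.ofPred_and, Set.ofPred_forall, Antitone]
  refine (isClosed_setOf_isHermitian.preimage continuous_fst).inter
    (IsClosed.inter (isClosed_iInter fun z => isClosed_eq ?_ ?_)
      (isClosed_iInter fun i => isClosed_iInter fun j => isClosed_iInter fun _ =>
        isClosed_le ?_ ?_))
  · exact (continuous_const.sub continuous_fst).matrix_det
  all_goals fun_prop

theorem isClosed_setOf_isDensityOp {I : Type*} [Fintype I] :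
    IsClosed {ρ : Matrix I I ℂ | IsDensityOp ρ} := by
  simp only [IsDensityOp, Matrix.posSemidef_iff_dotProduct_mulVec, Set.ofPred_and,
    Set.ofPred_forall]
  refine (isClosed_setOf_isHermitian.inter (isClosed_iInter fun x => isClosed_le
    continuous_const ?_)).inter (isClosed_eq continuous_id.matrix_trace continuous_const)
  exact continuous_const.dotProduct (continuous_id.matrix_mulVec continuous_const)

theorem IsDensityOp.norm_apply_le_one {I : Type*} [Fintype I] {ρ : Matrix I I ℂ}
    (hρ : IsDensityOp ρ) (i j : I) : ‖ρ i j‖ ≤ 1 := by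
  classical
  have hH := hρ.1.isHermitian
  set U : Matrix I I ℂ := hH.eigenvectorUnitary.1
  have hU : ∀ i j, ‖U i j‖ ≤ 1 :=
    entry_norm_bound_of_unitary hH.eigenvectorUnitary.2
  have hsum : ∑ k, hH.eigenvalues k = 1 := by
    have h := hH.trace_eq_sum_eigenvalues
    rw [hρ.2] at h
    exact Complex.ofReal_injective (by simpa using h.symm)
  have hentry : ρ i j = ∑ k, U i k * hH.eigenvalues k * star (U j k) := by
    have h := congrFun (congrFun hH.spectral_theorem i) j
    rw [Unitary.conjStarAlgAut_apply] at h
    rw [h, Matrix.mul_apply]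
    simp [Matrix.mul_diagonal, U, Matrix.star_apply]
  rw [hentry, ← hsum]
  refine norm_sum_le_of_le _ fun k _ => ?_
  have hk : 0 ≤ hH.eigenvalues k := hρ.1.eigenvalues_nonneg k
  rw [norm_mul, norm_mul, norm_star, Complex.norm_real, Real.norm_of_nonneg hk]
  calc ‖U i k‖ * hH.eigenvalues k * ‖U j k‖ ≤ 1 * hH.eigenvalues k * 1 := by
        gcongr <;> exact hU _ _
    _ = hH.eigenvalues k := by ring

theorem isCompact_setOf_isDensityOp {I : Type*} [Fintype I] :
    IsCompact {ρ : Matrix I I ℂ | IsDensityOp ρ} := by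
  have hK : IsCompact {ρ : Matrix I I ℂ | ∀ i j, ρ i j ∈ Metric.closedBall (0 : ℂ) 1} := by
    have h := isCompact_pi_infinite fun _ : I =>
      isCompact_pi_infinite fun _ : I => isCompact_closedBall (0 : ℂ) 1
    exact h
  exact hK.of_isClosed_subset isClosed_setOf_isDensityOp fun ρ hρ i j => by
    simpa using IsDensityOp.norm_apply_le_one hρ i j

/-- The entries of the spectrum are bounded by the sum of the norms of the matrix entries. -/
theorem IsSpectrum.abs_apply_le {d : ℕ} {I : Type*} [Fintype I] [DecidableEq I]
    {A : Matrix I I ℂ} {e : I ≃ Fin d} {a : I → ℝ} (h : IsSpectrum A e a) (i : I) :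
    |a i| ≤ ∑ j, ∑ k, ‖A j k‖ := by
  obtain ⟨hA, ⟨σ, rfl⟩, -⟩ := h
  have hv : ∀ j, ‖hA.eigenvectorBasis (σ i) j‖ ≤ 1 := fun j =>
    (PiLp.norm_apply_le _ j).trans_eq (hA.eigenvectorBasis.orthonormal.1 _)
  rw [Function.comp_apply, hA.eigenvalues_eq]
  refine (RCLike.abs_re_le_norm _).trans (norm_sum_le_of_le _ fun j _ => ?_)
  rw [norm_mul, Pi.star_apply, norm_star]
  refine (mul_le_of_le_one_left (norm_nonneg _) (hv j)).trans
    (norm_sum_le_of_le _ fun k _ => ?_)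
  rw [norm_mul]
  exact mul_le_of_le_one_right (norm_nonneg _) (hv k)

/-- The spectra of a continuous family of matrices over a compact set form a bounded set. -/
theorem exists_forall_isSpectrum_mem_Icc {X : Type*} [TopologicalSpace X] {K : Set X}
    (hK : IsCompact K) {d : ℕ} {I : Type*} [Fintype I] [DecidableEq I] {e : I ≃ Fin d}
    {f : X → Matrix I I ℂ} (hf : Continuous f) :
    ∃ C : ℝ, ∀ x ∈ K, ∀ a : I → ℝ, IsSpectrum (f x) e a →
      a ∈ Set.Icc (fun _ => -C) (fun _ => C) := by
  obtain ⟨C, hC⟩ := hK.bddAbove_image (f := fun x => ∑ j, ∑ k, ‖f x j k‖)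
    (continuous_finsetSum _ fun j _ => continuous_finsetSum _ fun k _ =>
      (hf.matrix_elem j k).norm).continuousOn
  refine ⟨C, fun x hx a ha => ?_⟩
  have hle : ∀ i, |a i| ≤ C := fun i =>
    (ha.abs_apply_le i).trans (hC (Set.mem_image_of_mem _ hx))
  exact ⟨fun i => (abs_le.1 (hle i)).1, fun i => (abs_le.1 (hle i)).2⟩

theorem continuous_ptraceB {I J : Type*} [Fintype J] :
    Continuous (ptraceB : Matrix (I × J) (I × J) ℂ → Matrix I I ℂ) :=
  continuous_matrix fun _ _ => continuous_finsetSum _ fun _ _ => continuous_id.matrix_elem _ _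

theorem continuous_ptraceA {I J : Type*} [Fintype I] :
    Continuous (ptraceA : Matrix (I × J) (I × J) ℂ → Matrix J J ℂ) :=
  continuous_matrix fun _ _ => continuous_finsetSum _ fun _ _ => continuous_id.matrix_elem _ _

/-- The set of admissible spectral triples is compact. -/
theorem qmp_isCompact (m n : ℕ) (hm : 0 < m) (hn : 0 < n) :
    IsCompact (QMP m n) := by
  have hK : IsCompact {ρ : Matrix (Fin m × Fin n) (Fin m × Fin n) ℂ | IsDensityOp ρ} :=
    isCompact_setOf_isDensityOp
  obtain ⟨C₁, h₁⟩ := exists_forall_isSpectrum_mem_Icc hK (e := Equiv.refl (Fin m))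
    continuous_ptraceB
  obtain ⟨C₂, h₂⟩ := exists_forall_isSpectrum_mem_Icc hK (e := Equiv.refl (Fin n))
    continuous_ptraceA
  obtain ⟨C₃, h₃⟩ := exists_forall_isSpectrum_mem_Icc hK (e := finProdFinEquiv) continuous_id
  let S : Set (Matrix (Fin m × Fin n) (Fin m × Fin n) ℂ ×
      ((Fin m → ℝ) × (Fin n → ℝ) × (Fin m × Fin n → ℝ))) :=
    {p | IsDensityOp p.1 ∧ IsSpectrum (ptraceB p.1) (Equiv.refl (Fin m)) p.2.1 ∧
      IsSpectrum (ptraceA p.1) (Equiv.refl (Fin n)) p.2.2.1 ∧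
      IsSpectrum p.1 finProdFinEquiv p.2.2.2}
  have hS : IsClosed S :=
    (isClosed_setOf_isDensityOp.preimage continuous_fst).inter
      (((isClosed_setOf_isSpectrum (Equiv.refl (Fin m))).preimage
        ((continuous_ptraceB.comp continuous_fst).prodMk (by fun_prop :
          Continuous fun p : Matrix (Fin m × Fin n) (Fin m × Fin n) ℂ ×
            ((Fin m → ℝ) × (Fin n → ℝ) × (Fin m × Fin n → ℝ)) => p.2.1))).inter
      (((isClosed_setOf_isSpectrum (Equiv.refl (Fin n))).preimage
        ((continuous_ptraceA.comp continuous_fst).prodMk (by fun_prop :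
          Continuous fun p : Matrix (Fin m × Fin n) (Fin m × Fin n) ℂ ×
            ((Fin m → ℝ) × (Fin n → ℝ) × (Fin m × Fin n → ℝ)) => p.2.2.1))).inter
      ((isClosed_setOf_isSpectrum finProdFinEquiv).preimage
        (continuous_fst.prodMk (by fun_prop :
          Continuous fun p : Matrix (Fin m × Fin n) (Fin m × Fin n) ℂ ×
            ((Fin m → ℝ) × (Fin n → ℝ) × (Fin m × Fin n → ℝ)) => p.2.2.2)))))
  have hSc : IsCompact S :=
    (hK.prod (isCompact_Icc.prod (isCompact_Icc.prod isCompact_Icc))).of_isClosed_subset hS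
      fun p hp => ⟨hp.1, h₁ _ hp.1 _ hp.2.1, h₂ _ hp.1 _ hp.2.2.1, h₃ _ hp.1 _ hp.2.2.2⟩
  convert hSc.image continuous_snd using 1
  ext t
  simp [QMP, S]
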